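/- For each δ with 1 − 1/γ ≤ δ < 1 there is a constant C > 0 such that for all β > 0 and all x, y ∈ ℝ: |K_β(x,y) − K^{(l)}_β(x,y)| ≤ C β^{2/γ} |x−y| (1 + (x−y)²)^{−(2−δ)}. -/

import Mathlib

open Real

/-- Algebraic core: a Lipschitz-type bound `s * r ^ (γ - 1)` on the difference of two symbols
controls the difference of the corresponding resolvent-type kernels. -/
theorem abs_inv_sub_inv_le_of_homogeneous_bound
    {γ δ β r s c M L a b D : ℝ} (hγ : 1 ≤ γ) (hδ₁ : 1 - 1 / γ ≤ δ) (hδ₂ : δ < 1)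
    (hβ : 0 < β) (hr : 0 < r) (hs : 0 ≤ s) (hc : 0 < c) (hM₁ : 1 ≤ M) (hM₂ : 1 ≤ M * c)
    (hL : 0 ≤ L) (hD : 1 ≤ D) (ha : c * r ^ γ ≤ a) (hb : 0 ≤ b)
    (hab : |a - b| ≤ L * s * r ^ (γ - 1)) :
    |(D + β ^ 2 * a)⁻¹ - (D + β ^ 2 * b)⁻¹| ≤
      L * M * β ^ ((2 : ℝ) / γ) * s * D ^ (-(2 - δ)) := by
  have hγ0 : 0 < γ := by linarith
  have hM0 : 0 < M := by linarith
  have ha0 : 0 ≤ a := le_trans (by positivity) ha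
  have hD0 : 0 < D := by linarith
  set E := D + β ^ 2 * a with hE
  set F := D + β ^ 2 * b with hF
  have hDE : D ≤ E := by rw [hE]; nlinarith [mul_nonneg (sq_nonneg β) ha0]
  have hDF : D ≤ F := by rw [hF]; nlinarith [mul_nonneg (sq_nonneg β) hb]
  have hE0 : 0 < E := by linarith
  have hF0 : 0 < F := by linarith
  have hscale : β ^ 2 * r ^ γ ≤ M * E := by
    have h1 : β ^ 2 * r ^ γ ≤ M * (β ^ 2 * a) := by
      calc β ^ 2 * r ^ γ ≤ (M * c) * (β ^ 2 * r ^ γ) := le_mul_of_one_le_left (by positivity) hM₂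
        _ = M * (β ^ 2 * (c * r ^ γ)) := by ring
        _ ≤ M * (β ^ 2 * a) := by gcongr
    have : M * (β ^ 2 * a) ≤ M * E := by gcongr; linarith
    linarith
  have hME : 1 ≤ M * E := one_le_mul_of_one_le_of_one_le hM₁ (by linarith)
  have hexp : 0 ≤ 1 - 1 / γ := by
    have : 1 / γ ≤ 1 := (div_le_one hγ0).2 hγ
    linarith
  have hsplit : β ^ 2 * r ^ (γ - 1) =
      β ^ ((2 : ℝ) / γ) * (β ^ 2 * r ^ γ) ^ (1 - 1 / γ) := by
    rw [mul_rpow (by positivity) (by positivity), ← rpow_natCast, ← rpow_mul hβ.le,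
      ← rpow_mul hr.le, ← mul_assoc, ← rpow_add hβ]
    congr 2
    · field_simp
      push_cast
      ring
    · field_simp
  have hpow : (β ^ 2 * r ^ γ) ^ (1 - 1 / γ) ≤ M * E ^ δ := by
    calc (β ^ 2 * r ^ γ) ^ (1 - 1 / γ) ≤ (M * E) ^ (1 - 1 / γ) := by gcongr
      _ ≤ (M * E) ^ δ := rpow_le_rpow_of_exponent_le hME hδ₁
      _ = M ^ δ * E ^ δ := mul_rpow hM0.le hE0.le
      _ ≤ M * E ^ δ := by
        gcongr
        simpa using rpow_le_rpow_of_exponent_le hM₁ hδ₂.le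
  have hnum : β ^ 2 * |a - b| ≤ L * M * β ^ ((2 : ℝ) / γ) * s * E ^ δ := by
    calc β ^ 2 * |a - b| ≤ β ^ 2 * (L * s * r ^ (γ - 1)) := by gcongr
      _ = L * s * (β ^ 2 * r ^ (γ - 1)) := by ring
      _ = L * s * (β ^ ((2 : ℝ) / γ) * (β ^ 2 * r ^ γ) ^ (1 - 1 / γ)) := by rw [hsplit]
      _ ≤ L * s * (β ^ ((2 : ℝ) / γ) * (M * E ^ δ)) := by gcongr
      _ = _ := by ring
  have hdiff : |E⁻¹ - F⁻¹| = β ^ 2 * |a - b| * (E⁻¹ * F⁻¹) := by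
    have : E⁻¹ - F⁻¹ = β ^ 2 * (b - a) * (E⁻¹ * F⁻¹) := by
      have h : β ^ 2 * (b - a) = F - E := by rw [hE, hF]; ring
      rw [h]; field_simp
    rw [this, abs_mul, abs_mul, abs_of_nonneg (sq_nonneg β), abs_sub_comm,
      abs_of_pos (by positivity : 0 < E⁻¹ * F⁻¹)]
  have hED : E ^ (δ - 1) ≤ D ^ (δ - 1) := rpow_le_rpow_of_nonpos hD0 hDE (by linarith)
  have hden : E ^ δ * (E⁻¹ * F⁻¹) ≤ D ^ (-(2 - δ)) := by
    calc E ^ δ * (E⁻¹ * F⁻¹) = E ^ (δ - 1) * F⁻¹ := by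
          rw [rpow_sub_one hE0.ne']; ring
      _ ≤ D ^ (δ - 1) * D⁻¹ := by
        exact mul_le_mul hED (inv_anti₀ hD0 hDF) (by positivity) (rpow_nonneg hD0.le _)
      _ = D ^ (-(2 - δ)) := by
        rw [← rpow_neg_one D, ← rpow_add hD0]; congr 1; ring
  calc |E⁻¹ - F⁻¹| = β ^ 2 * |a - b| * (E⁻¹ * F⁻¹) := hdiff
    _ ≤ L * M * β ^ ((2 : ℝ) / γ) * s * E ^ δ * (E⁻¹ * F⁻¹) := by gcongr
    _ = L * M * β ^ ((2 : ℝ) / γ) * s * (E ^ δ * (E⁻¹ * F⁻¹)) := by ring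
    _ ≤ _ := by gcongr

/-- Homogeneity extends bounds on the unit circle to the punctured plane. -/
theorem homogeneous_bounds {γ c₀ C₀ : ℝ} {Θ : ℝ → ℝ → ℝ}
    (hhom : ∀ t x y : ℝ, 0 < t → Θ (t * x) (t * y) = t ^ γ * Θ x y)
    (hlow : ∀ x y : ℝ, x ^ 2 + y ^ 2 = 1 → c₀ ≤ Θ x y)
    (hupp : ∀ x y : ℝ, x ^ 2 + y ^ 2 = 1 → Θ x y ≤ C₀)
    {x y : ℝ} (hxy : 0 < x ^ 2 + y ^ 2) :
    c₀ * √(x ^ 2 + y ^ 2) ^ γ ≤ Θ x y ∧ Θ x y ≤ C₀ * √(x ^ 2 + y ^ 2) ^ γ := by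
  have hr : 0 < √(x ^ 2 + y ^ 2) := sqrt_pos.2 hxy
  have hr2 : √(x ^ 2 + y ^ 2) ^ 2 = x ^ 2 + y ^ 2 := sq_sqrt hxy.le
  set r := √(x ^ 2 + y ^ 2)
  have hunit : (x / r) ^ 2 + (y / r) ^ 2 = 1 := by
    rw [div_pow, div_pow, ← add_div, hr2, div_self hxy.ne']
  have h := hhom r (x / r) (y / r) hr
  rw [mul_div_cancel₀ _ hr.ne', mul_div_cancel₀ _ hr.ne'] at h
  have hrγ : 0 ≤ r ^ γ := rpow_nonneg hr.le _
  rw [h, mul_comm c₀, mul_comm C₀]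
  exact ⟨mul_le_mul_of_nonneg_left (hlow _ _ hunit) hrγ,
    mul_le_mul_of_nonneg_left (hupp _ _ hunit) hrγ⟩

/-- A homogeneous function of positive degree vanishes at the origin. -/
theorem homogeneous_zero {γ : ℝ} (hγ : 0 < γ) {Θ : ℝ → ℝ → ℝ}
    (hhom : ∀ t x y : ℝ, 0 < t → Θ (t * x) (t * y) = t ^ γ * Θ x y) : Θ 0 0 = 0 := by
  have h := hhom 2 0 0 two_pos
  have h2 : (1 : ℝ) < 2 ^ γ := one_lt_rpow one_lt_two hγ
  rw [mul_zero] at h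
  have : ((2 : ℝ) ^ γ - 1) * Θ 0 0 = 0 := by linarith
  exact (mul_eq_zero.1 this).resolve_left (by linarith)

/-- If `y` is close to `x` relative to `|x|`, the local Lipschitz bounds at `(1, 1)` and
`(-1, -1)` transfer to `(x, x)` by homogeneity. -/
theorem abs_sub_diag_le_of_near {γ ε CL : ℝ} {Θ : ℝ → ℝ → ℝ}
    (hhom : ∀ t x y : ℝ, 0 < t → Θ (t * x) (t * y) = t ^ γ * Θ x y)
    (hsymm : ∀ x y : ℝ, Θ x y = Θ y x)
    (hlip1 : ∀ t : ℝ, t ∈ Set.Ioo (1 - ε) (1 + ε) → |Θ t 1 - Θ 1 1| ≤ CL * |t - 1|)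
    (hlip2 : ∀ t : ℝ, t ∈ Set.Ioo (-1 - ε) (-1 + ε) → |Θ t (-1) - Θ (-1) (-1)| ≤ CL * |t + 1|)
    {x y : ℝ} (hx : x ≠ 0) (hnear : |x - y| < ε * |x|) :
    |Θ x y - Θ x x| ≤ CL * |x - y| * |x| ^ (γ - 1) := by
  have ht : 0 < |x| := abs_pos.2 hx
  rw [hsymm x y, rpow_sub_one ht.ne']
  have key : ∀ e : ℝ, |x| * e = x →
      |Θ (y / |x|) e - Θ e e| ≤ CL * |y / |x| - e| →
      |Θ y x - Θ x x| ≤ CL * |x - y| * (|x| ^ γ / |x|) := by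
    intro e he h
    have h1 := hhom |x| (y / |x|) e ht
    have h2 := hhom |x| e e ht
    rw [mul_div_cancel₀ _ ht.ne', he] at h1
    rw [he] at h2
    have h3 : |y / |x| - e| = |x - y| / |x| := by
      have : y / |x| - e = (y - x) / |x| := by
        rw [eq_div_iff ht.ne', sub_mul, div_mul_cancel₀ _ ht.ne', mul_comm e, he]
      rw [this, abs_div, abs_abs, abs_sub_comm]
    have hp : 0 ≤ |x| ^ γ := rpow_nonneg ht.le _
    rw [h1, h2, ← mul_sub, abs_mul, abs_of_nonneg hp]
    calc |x| ^ γ * |Θ (y / |x|) e - Θ e e| ≤ |x| ^ γ * (CL * |y / |x| - e|) := by gcongr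
      _ = _ := by rw [h3]; ring
  have hnear' := abs_lt.1 hnear
  rcases lt_or_gt_of_ne hx with hneg | hpos
  · have hax : |x| = -x := abs_of_neg hneg
    refine key (-1) (by rw [hax]; ring) ?_
    rw [sub_neg_eq_add]
    refine hlip2 _ ⟨?_, ?_⟩
    · rw [lt_div_iff₀ ht]; rw [hax] at hnear' ⊢; linarith
    · rw [div_lt_iff₀ ht]; rw [hax] at hnear' ⊢; linarith
  · have hax : |x| = x := abs_of_pos hpos
    refine key 1 (by rw [hax]; ring) (hlip1 _ ⟨?_, ?_⟩)
    · rw [lt_div_iff₀ ht]; rw [hax] at hnear' ⊢; linarith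
    · rw [div_lt_iff₀ ht]; rw [hax] at hnear' ⊢; linarith

/-- For each `δ` with `1 − 1/γ ≤ δ < 1` there is `C > 0` such that for all
`β > 0` and all `x, y`,
`|K_β(x,y) − K^{(l)}_β(x,y)| ≤ C β^{2/γ} |x−y| (1+(x−y)²)^{−(2−δ)}`,
where `K_β(x,y) = (1/π)(1+(x−y)²+β²Θ(x,y))⁻¹` and
`K^{(l)}_β(x,y) = (1/π)(1+(x−y)²+β²Θ(x,x))⁻¹`. -/
theorem statement7
    (γ : ℝ) (hγ : 1 ≤ γ)
    (Θ : ℝ → ℝ → ℝ)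
    (hhom : ∀ t x y : ℝ, 0 < t → Θ (t * x) (t * y) = t ^ γ * Θ x y)
    (hsymm : ∀ x y : ℝ, Θ x y = Θ y x)
    (c₀ C₀ : ℝ) (hc₀ : 0 < c₀) (hc₀C₀ : c₀ ≤ C₀)
    (hlow : ∀ x y : ℝ, x ^ 2 + y ^ 2 = 1 → c₀ ≤ Θ x y)
    (hupp : ∀ x y : ℝ, x ^ 2 + y ^ 2 = 1 → Θ x y ≤ C₀)
    (ε CL : ℝ) (hε : 0 < ε) (hCL : 0 < CL)
    (hlip1 : ∀ t : ℝ, t ∈ Set.Ioo (1 - ε) (1 + ε) → |Θ t 1 - Θ 1 1| ≤ CL * |t - 1|)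
    (hlip2 : ∀ t : ℝ, t ∈ Set.Ioo (-1 - ε) (-1 + ε) → |Θ t (-1) - Θ (-1) (-1)| ≤ CL * |t + 1|)
    (K Kl : ℝ → ℝ → ℝ → ℝ)
    (hK : ∀ β x y : ℝ, K β x y = (1 / π) * (1 + (x - y) ^ 2 + β ^ 2 * Θ x y)⁻¹)
    (hKl : ∀ β x y : ℝ, Kl β x y = (1 / π) * (1 + (x - y) ^ 2 + β ^ 2 * Θ x x)⁻¹)
    (δ : ℝ) (hδ₁ : 1 - 1 / γ ≤ δ) (hδ₂ : δ < 1) :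
    ∃ C : ℝ, 0 < C ∧ ∀ β : ℝ, 0 < β → ∀ x y : ℝ,
      |K β x y - Kl β x y| ≤
        C * β ^ ((2 : ℝ) / γ) * |x - y| * (1 + (x - y) ^ 2) ^ (-(2 - δ)) := by
  have hγ0 : 0 < γ := by linarith
  have hC₀ : 0 < C₀ := by linarith
  set L := CL + C₀ * 2 ^ γ * (2 / ε + 1) with hLdef
  set M := 1 + 1 / c₀ with hMdef
  have hL : 0 < L := by positivity
  have hM₁ : 1 ≤ M := by rw [hMdef]; linarith [one_div_pos.2 hc₀]
  have hM₂ : 1 ≤ M * c₀ := by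
    rw [hMdef, add_mul, one_div_mul_cancel hc₀.ne']; linarith
  refine ⟨L * M, by positivity, fun β hβ x y => ?_⟩
  rw [hK, hKl, ← mul_sub, abs_mul, abs_of_pos (by positivity : 0 < 1 / π)]
  have hπ : 1 / π ≤ 1 := (div_le_one pi_pos).2 (by linarith [pi_gt_three])
  refine (mul_le_of_le_one_left (abs_nonneg _) hπ).trans ?_
  have hD : 1 ≤ 1 + (x - y) ^ 2 := by linarith [sq_nonneg (x - y)]
  rcases eq_or_ne x y with rfl | hne
  · simp
  have hr2 : 0 < x ^ 2 + y ^ 2 := by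
    by_contra! h
    have hx : x = 0 := by nlinarith [sq_nonneg x, sq_nonneg y]
    have hy : y = 0 := by nlinarith [sq_nonneg x, sq_nonneg y]
    exact hne (hx.trans hy.symm)
  obtain ⟨hlowxy, huppxy⟩ := homogeneous_bounds hhom hlow hupp hr2
  have hr : 0 < √(x ^ 2 + y ^ 2) := sqrt_pos.2 hr2
  have hxr : |x| ≤ √(x ^ 2 + y ^ 2) := abs_le_sqrt (by linarith [sq_nonneg y])
  have hrle : √(x ^ 2 + y ^ 2) ≤ |x| + |y| := by
    refine sqrt_le_iff.2 ⟨by positivity, ?_⟩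
    nlinarith [mul_nonneg (abs_nonneg x) (abs_nonneg y), sq_abs x, sq_abs y]
  set r := √(x ^ 2 + y ^ 2)
  have h2γ : (1 : ℝ) ≤ 2 ^ γ := one_le_rpow one_le_two hγ0.le
  have hdiag : 0 ≤ Θ x x ∧ Θ x x ≤ C₀ * 2 ^ γ * r ^ γ := by
    rcases eq_or_ne x 0 with rfl | hx
    · rw [homogeneous_zero hγ0 hhom]
      exact ⟨le_rfl, by positivity⟩
    · have hxx : 0 < x ^ 2 + x ^ 2 := by positivity
      obtain ⟨h1, h2⟩ := homogeneous_bounds hhom hlow hupp hxx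
      refine ⟨le_trans (by positivity) h1, h2.trans ?_⟩
      rw [mul_assoc, ← mul_rpow two_pos.le hr.le]
      gcongr
      refine sqrt_le_iff.2 ⟨by positivity, ?_⟩
      nlinarith [mul_self_le_mul_self (abs_nonneg x) hxr, sq_abs x]
  refine abs_inv_sub_inv_le_of_homogeneous_bound hγ hδ₁ hδ₂ hβ hr (abs_nonneg _) hc₀ hM₁ hM₂
    hL.le hD hlowxy hdiag.1 ?_
  by_cases hnear : |x - y| < ε * |x|
  · have hx : x ≠ 0 := by
      rintro rfl
      rw [abs_zero, mul_zero] at hnear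
      exact absurd hnear (abs_nonneg _).not_gt
    refine (abs_sub_diag_le_of_near hhom hsymm hlip1 hlip2 hx hnear).trans ?_
    have hCLL : CL ≤ L := by
      rw [hLdef]
      have : 0 ≤ C₀ * 2 ^ γ * (2 / ε + 1) := by positivity
      linarith
    have : |x| ^ (γ - 1) ≤ r ^ (γ - 1) := rpow_le_rpow (abs_nonneg _) hxr (by linarith)
    gcongr
  · have hxs : |x| ≤ |x - y| / ε := by
      rw [le_div_iff₀ hε]; linarith [not_lt.1 hnear]
    have hys : |y| ≤ |x| + |x - y| := by
      have := abs_sub_abs_le_abs_sub y x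
      rw [abs_sub_comm] at this; linarith
    have hrs : r ≤ (2 / ε + 1) * |x - y| := by
      have : (2 / ε + 1) * |x - y| = 2 * (|x - y| / ε) + |x - y| := by ring
      linarith
    have hxy0 : 0 ≤ Θ x y := le_trans (by positivity) hlowxy
    have hxyu : Θ x y ≤ C₀ * 2 ^ γ * r ^ γ :=
      huppxy.trans (by gcongr; exact le_mul_of_one_le_right hC₀.le h2γ)
    calc |Θ x y - Θ x x| ≤ C₀ * 2 ^ γ * r ^ γ :=
          abs_sub_le_of_nonneg_of_le hxy0 hxyu hdiag.1 hdiag.2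
      _ = C₀ * 2 ^ γ * r * r ^ (γ - 1) := by
        rw [rpow_sub_one hr.ne']; field_simp
      _ ≤ C₀ * 2 ^ γ * ((2 / ε + 1) * |x - y|) * r ^ (γ - 1) := by gcongr
      _ ≤ L * |x - y| * r ^ (γ - 1) := by
        rw [← mul_assoc]
        gcongr
        rw [hLdef]
        linarith
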